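/- arXiv:2507.15176 — 2 statements merged into one kernel-verified Lean document; each statement's English description precedes it below -/
import Mathlib

section
/- Let X be a nonempty finite set, let P be a Markov transition matrix on X, let μ be a distribution on X, and let δ ∈ (0,1]. Then the function π_δ : X → ℝ defined by π_δ(y) := δ Σ_{t=0}^∞ (1−δ)^t (μP^t)(y) is a well-defined distribution on X, and it is the unique stationary distribution of the PageRank chain P(δ)(x,y) := (1−δ) P(x,y) + δ μ(y). Equivalently, π_δ is the unique distribution satisfying π_δ = δμ + (1−δ) π_δ P. -/
open Finset

/-- The `t`-step evolution of a row vector `ν` under the transition matrix `P`. -/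
noncomputable def evolve {X : Type*} [Fintype X] (P : X → X → ℝ) (ν : X → ℝ) : ℕ → X → ℝ
  | 0 => ν
  | t + 1 => fun y => ∑ x, evolve P ν t x * P x y

section

variable {X : Type*} [Fintype X] {P : X → X → ℝ} {μ : X → ℝ} {δ : ℝ}

lemma evolve_nonneg (hP : ∀ x y, 0 ≤ P x y) (hμ : ∀ x, 0 ≤ μ x) (t : ℕ) (y : X) :
    0 ≤ evolve P μ t y := by
  induction t generalizing y with
  | zero => exact hμ y
  | succ t ih => exact sum_nonneg fun x _ => mul_nonneg (ih x) (hP x y)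

lemma sum_sum_mul_of_sum_eq_one (hP : ∀ x, ∑ y, P x y = 1) (ν : X → ℝ) :
    ∑ y, ∑ x, ν x * P x y = ∑ x, ν x := by
  rw [sum_comm]
  simp only [← mul_sum, hP, mul_one]

lemma sum_evolve (hP : ∀ x, ∑ y, P x y = 1) (t : ℕ) : ∑ y, evolve P μ t y = ∑ y, μ y := by
  induction t with
  | zero => rfl
  | succ t ih => exact (sum_sum_mul_of_sum_eq_one hP _).trans ih

lemma summable_pow_mul_evolve (hP0 : ∀ x y, 0 ≤ P x y) (hP1 : ∀ x, ∑ y, P x y = 1)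
    (hμ : ∀ x, 0 ≤ μ x) (hδ0 : 0 < δ) (hδ1 : δ ≤ 1) (y : X) :
    Summable fun t : ℕ => (1 - δ) ^ t * evolve P μ t y := by
  have hδ : 0 ≤ 1 - δ := by linarith
  refine Summable.of_nonneg_of_le
    (fun t => mul_nonneg (pow_nonneg hδ t) (evolve_nonneg hP0 hμ t y)) (fun t => ?_)
    ((summable_geometric_of_lt_one hδ (by linarith)).mul_right (∑ x, μ x))
  refine mul_le_mul_of_nonneg_left ?_ (pow_nonneg hδ t)
  rw [← sum_evolve hP1 t]
  exact single_le_sum (fun x _ => evolve_nonneg hP0 hμ t x) (mem_univ y)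

lemma pagerank_sum_mul {σ : X → ℝ} (hσ : ∑ x, σ x = 1) (y : X) :
    ∑ x, σ x * ((1 - δ) * P x y + δ * μ y) = δ * μ y + (1 - δ) * ∑ x, σ x * P x y := by
  simp only [mul_add, sum_add_distrib, ← sum_mul, hσ, mul_left_comm _ (1 - δ), ← mul_sum]
  ring

/-- The affine map `σ ↦ δμ + (1−δ)σP` is an `ℓ¹` contraction, so it has at most one fixed point. -/
lemma pagerank_fixedPoint_unique (hP0 : ∀ x y, 0 ≤ P x y) (hP1 : ∀ x, ∑ y, P x y = 1)
    (hδ0 : 0 < δ) (hδ1 : δ ≤ 1) {σ τ : X → ℝ}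
    (hσ : ∀ y, σ y = δ * μ y + (1 - δ) * ∑ x, σ x * P x y)
    (hτ : ∀ y, τ y = δ * μ y + (1 - δ) * ∑ x, τ x * P x y) : σ = τ := by
  have hδ : 0 ≤ 1 - δ := by linarith
  have hle : ∑ y, |σ y - τ y| ≤ (1 - δ) * ∑ y, |σ y - τ y| := by
    calc ∑ y, |σ y - τ y| ≤ ∑ y, (1 - δ) * ∑ x, |σ x - τ x| * P x y := by
          refine sum_le_sum fun y _ => ?_
          have h : σ y - τ y = (1 - δ) * ∑ x, (σ x - τ x) * P x y := by
            simp only [sub_mul (σ _), sum_sub_distrib]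
            linarith [hσ y, hτ y]
          rw [h, abs_mul, abs_of_nonneg hδ]
          refine mul_le_mul_of_nonneg_left ((abs_sum_le_sum_abs _ _).trans_eq ?_) hδ
          simp only [abs_mul, abs_of_nonneg (hP0 _ _)]
      _ = (1 - δ) * ∑ y, |σ y - τ y| := by
          rw [← mul_sum, sum_sum_mul_of_sum_eq_one hP1]
  have hnn : 0 ≤ ∑ y, |σ y - τ y| := sum_nonneg fun y _ => abs_nonneg _
  have hzero : ∑ y, |σ y - τ y| = 0 := by nlinarith
  funext y
  have hy := (sum_eq_zero_iff_of_nonneg fun y _ => abs_nonneg _).1 hzero y (mem_univ y)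
  exact sub_eq_zero.1 (abs_eq_zero.1 hy)

end

/-- For `δ ∈ (0,1]`, the function
`π_δ(y) = δ Σ_{t≥0} (1−δ)^t (μP^t)(y)` is a well-defined distribution, is the
unique stationary distribution of the PageRank chain `P(δ) = (1−δ)P + δ𝟙ᵀμ`,
and equivalently is the unique distribution with `π_δ = δμ + (1−δ)π_δ P`. -/
theorem pagerank_stationary_von_neumann {X : Type*} [Fintype X] [Nonempty X]
    (P : X → X → ℝ) (μ : X → ℝ) (δ : ℝ)
    (hP0 : ∀ x y, 0 ≤ P x y) (hP1 : ∀ x, ∑ y, P x y = 1)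
    (hμ0 : ∀ x, 0 ≤ μ x) (hμ1 : ∑ x, μ x = 1)
    (hδ0 : 0 < δ) (hδ1 : δ ≤ 1)
    (πδ : X → ℝ)
    (hπδ : ∀ y, πδ y = δ * ∑' t : ℕ, (1 - δ) ^ t * evolve P μ t y) :
    (∀ y, Summable fun t : ℕ => (1 - δ) ^ t * evolve P μ t y) ∧
    (∀ y, 0 ≤ πδ y) ∧ (∑ y, πδ y = 1) ∧
    (∀ y, ∑ x, πδ x * ((1 - δ) * P x y + δ * μ y) = πδ y) ∧
    (∀ σ : X → ℝ, (∀ x, 0 ≤ σ x) → (∑ x, σ x = 1) →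
      (∀ y, ∑ x, σ x * ((1 - δ) * P x y + δ * μ y) = σ y) → σ = πδ) ∧
    (∀ y, πδ y = δ * μ y + (1 - δ) * ∑ x, πδ x * P x y) ∧
    (∀ σ : X → ℝ, (∀ x, 0 ≤ σ x) → (∑ x, σ x = 1) →
      (∀ y, σ y = δ * μ y + (1 - δ) * ∑ x, σ x * P x y) → σ = πδ) := by
  have hδ : 0 ≤ 1 - δ := by linarith
  have hs := summable_pow_mul_evolve hP0 hP1 hμ0 hδ0 hδ1
  have hsum : ∑ y, πδ y = 1 := by
    simp only [hπδ, ← mul_sum]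
    rw [← Summable.tsum_finsetSum fun y _ => hs y]
    simp only [← mul_sum, sum_evolve hP1, hμ1, mul_one]
    rw [tsum_geometric_of_lt_one hδ (by linarith), sub_sub_cancel, mul_inv_cancel₀ hδ0.ne']
  have hfix : ∀ y, πδ y = δ * μ y + (1 - δ) * ∑ x, πδ x * P x y := by
    intro y
    have hstep : ∑' t : ℕ, (1 - δ) ^ (t + 1) * evolve P μ (t + 1) y =
        (1 - δ) * ∑ x, (∑' t : ℕ, (1 - δ) ^ t * evolve P μ t x) * P x y := by
      simp only [← tsum_mul_right]
      rw [← Summable.tsum_finsetSum fun x _ => (hs x).mul_right _, ← tsum_mul_left]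
      refine tsum_congr fun t => ?_
      simp only [evolve, mul_sum]
      exact sum_congr rfl fun x _ => by ring
    rw [hπδ y, (hs y).tsum_eq_zero_add, hstep]
    simp only [hπδ, mul_assoc δ, ← mul_sum, evolve, pow_zero, one_mul]
    ring
  refine ⟨hs, fun y => ?_, hsum, fun y => ?_, fun σ _ h1 h => ?_, hfix, fun σ _ _ h => ?_⟩
  · rw [hπδ]
    exact mul_nonneg hδ0.le
      (tsum_nonneg fun t => mul_nonneg (pow_nonneg hδ t) (evolve_nonneg hP0 hμ0 t y))
  · rw [pagerank_sum_mul hsum, ← hfix]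
  · exact pagerank_fixedPoint_unique hP0 hP1 hδ0 hδ1
      (fun y => (h y).symm.trans (pagerank_sum_mul h1 y)) hfix
  · exact pagerank_fixedPoint_unique hP0 hP1 hδ0 hδ1 h hfix
end

section
/- There exists an absolute constant C > 0 with the following property. Let X be a finite set of cardinality n ≥ 1, let P be a Markov transition matrix on X with stationary distribution π and spectral gap at least γ for some γ ∈ (0,1], and suppose α/n ≤ π(x) ≤ 1/(αn) for all x and some α ∈ (0,1]. Let ε ∈ (0,1) and suppose P̃ is a Markov transition matrix such that the set S := {x : P̃(x,·) ≠ P(x,·)} satisfies |S| ≤ εn. Then there exists δ ∈ (0,1] such that the unique stationary distribution π̂ of the PageRank chain P̃(δ)(x,y) := (1−δ)P̃(x,y) + δ/n (uniform restart) satisfies d_TV(π̂, π) ≤ (C/α) · sqrt( (ε/γ) · (1 + log(1/(α ε γ))) ), where d_TV(ν, π) := (1/2) Σ_x |ν(x) − π(x)|. -/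
open Finset

/-- The spectral gap of a transition matrix `P` with respect to a distribution `π`. -/
noncomputable def specGap {X : Type*} [Fintype X] (P : X → X → ℝ) (π : X → ℝ) : ℝ :=
  1 - sSup { r : ℝ | ∃ f : X → ℝ, f ≠ 0 ∧ ∑ x, π x * f x = 0 ∧
      r = Real.sqrt (∑ x, π x * |∑ y, P x y * f y| ^ 2) /
          Real.sqrt (∑ x, π x * |f x| ^ 2) }

/-- The action `v ↦ vK` of a kernel on row vectors. -/
def push {X : Type*} [Fintype X] (K : X → X → ℝ) (v : X → ℝ) (y : X) : ℝ := ∑ x, v x * K x y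

section push
variable {X : Type*} [Fintype X] {K : X → X → ℝ}

lemma push_linear (K : X → X → ℝ) (a b : ℝ) (u v : X → ℝ) :
    push K (fun x => a * u x + b * v x) = fun y => a * push K u y + b * push K v y := by
  funext y
  simp only [push, mul_sum, ← sum_add_distrib]
  exact sum_congr rfl fun x _ => by ring

lemma sum_push_mul (K : X → X → ℝ) (v f : X → ℝ) :
    ∑ y, push K v y * f y = ∑ x, v x * ∑ y, K x y * f y := by
  simp only [push, sum_mul, mul_sum]
  rw [sum_comm]
  exact sum_congr rfl fun x _ => sum_congr rfl fun y _ => by ring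

lemma sum_push (K : X → X → ℝ) (v : X → ℝ) : ∑ y, push K v y = ∑ x, v x * ∑ y, K x y := by
  simpa using sum_push_mul K v 1

lemma sum_push_eq (h1 : ∀ x, ∑ y, K x y = 1) (v : X → ℝ) : ∑ y, push K v y = ∑ x, v x := by
  simp [sum_push, h1]

lemma sum_abs_push_le (h0 : ∀ x y, 0 ≤ K x y) (h1 : ∀ x, ∑ y, K x y = 1) (v : X → ℝ) :
    ∑ y, |push K v y| ≤ ∑ x, |v x| := by
  calc ∑ y, |push K v y| ≤ ∑ y, push K (fun x => |v x|) y := by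
        refine sum_le_sum fun y _ => (abs_sum_le_sum_abs _ _).trans_eq ?_
        exact sum_congr rfl fun x _ => by rw [abs_mul, abs_of_nonneg (h0 x y)]
    _ = ∑ x, |v x| := sum_push_eq h1 _

/-- Comparison principle for the resolvent of a substochastic kernel. -/
lemma nonneg_of_mul_push_le (h0 : ∀ x y, 0 ≤ K x y) (h1 : ∀ x, ∑ y, K x y ≤ 1)
    {a : ℝ} (ha0 : 0 ≤ a) (ha1 : a < 1) {v : X → ℝ} (hv : ∀ y, a * push K v y ≤ v y) (y : X) :
    0 ≤ v y := by
  have hneg : ∀ y, max (-v y) 0 ≤ a * push K (fun x => max (-v x) 0) y := by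
    intro y
    refine max_le ?_ (mul_nonneg ha0 (sum_nonneg fun x _ => mul_nonneg (le_max_right _ _) (h0 x y)))
    have : -push K v y ≤ push K (fun x => max (-v x) 0) y := by
      simp only [push, ← sum_neg_distrib]
      refine sum_le_sum fun x _ => ?_
      rw [← neg_mul]
      exact mul_le_mul_of_nonneg_right (le_max_left _ _) (h0 x y)
    nlinarith [hv y, mul_le_mul_of_nonneg_left this ha0]
  have hsum : ∑ y, max (-v y) 0 ≤ a * ∑ y, max (-v y) 0 := by
    refine (sum_le_sum fun y _ => hneg y).trans ?_
    rw [← mul_sum, sum_push]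
    refine mul_le_mul_of_nonneg_left (sum_le_sum fun x _ => ?_) ha0
    exact mul_le_of_le_one_right (le_max_right _ _) (h1 x)
  have hle : max (-v y) 0 ≤ ∑ y, max (-v y) 0 :=
    single_le_sum (f := fun y => max (-v y) 0) (fun _ _ => le_max_right _ _) (mem_univ y)
  have hle' := le_max_left (-v y) 0
  nlinarith

lemma exists_eq_add_mul_push (h0 : ∀ x y, 0 ≤ K x y) (h1 : ∀ x, ∑ y, K x y ≤ 1)
    {a : ℝ} (ha0 : 0 ≤ a) (ha1 : a < 1) (g : X → ℝ) :
    ∃ v : X → ℝ, ∀ y, v y = g y + a * push K v y := by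
  let T : (X → ℝ) →ₗ[ℝ] (X → ℝ) :=
    { toFun := fun v y => v y - a * push K v y
      map_add' := fun u v => by
        have := push_linear K 1 1 u v
        simp only [one_mul] at this
        funext y
        simp only [Pi.add_apply]
        rw [show u + v = fun x => u x + v x from rfl, this]
        ring
      map_smul' := fun c u => by
        have := push_linear K c 0 u u
        simp only [zero_mul, add_zero] at this
        funext y
        simp only [Pi.smul_apply, smul_eq_mul, RingHom.id_apply]
        rw [show c • u = fun x => c * u x from rfl, this]
        ring }
  have hinj : Function.Injective T := by
    rw [← LinearMap.ker_eq_bot, LinearMap.ker_eq_bot']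
    intro v hv
    have hv' : ∀ y, v y - a * push K v y = 0 := fun y => congrFun hv y
    funext y
    refine le_antisymm ?_
      (nonneg_of_mul_push_le h0 h1 ha0 ha1 (fun y => by linarith [hv' y]) y)
    have := nonneg_of_mul_push_le h0 h1 ha0 ha1 (v := fun x => -v x) (fun y => by
      have := push_linear K (-1) 0 v v
      simp only [neg_mul, one_mul, zero_mul, add_zero] at this
      rw [this]
      linarith [hv' y]) y
    simpa using this
  obtain ⟨v, hv⟩ := (LinearMap.injective_iff_surjective.mp hinj) g
  exact ⟨v, fun y => by linarith [show v y - a * push K v y = g y from congrFun hv y]⟩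

end push

section gap
variable {X : Type*} [Fintype X] {P : X → X → ℝ} {π : X → ℝ}

/-- The squared `L²(π)` norm of the density of `v` with respect to `π`. -/
noncomputable def densSq (π v : X → ℝ) : ℝ := ∑ x, v x ^ 2 / π x

lemma densSq_nonneg (hπ : ∀ x, 0 < π x) (v : X → ℝ) : 0 ≤ densSq π v :=
  sum_nonneg fun x _ => div_nonneg (sq_nonneg _) (hπ x).le

lemma sum_mul_div_le (hπ : ∀ x, 0 < π x) (u v : X → ℝ) :
    ∑ x, u x * v x / π x ≤ √(densSq π u) * √(densSq π v) := by
  have h := Real.sum_mul_le_sqrt_mul_sqrt univ (fun x => u x / √(π x)) (fun x => v x / √(π x))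
  refine le_of_eq_of_le (sum_congr rfl fun x _ => ?_) (h.trans_eq ?_)
  · rw [div_mul_div_comm, Real.mul_self_sqrt (hπ x).le]
  · simp only [div_pow, Real.sq_sqrt (hπ _).le, densSq]

lemma sum_abs_le_sqrt_densSq (hπ : ∀ x, 0 < π x) (hsum : ∑ x, π x = 1) (v : X → ℝ) :
    ∑ x, |v x| ≤ √(densSq π v) := by
  have h := sum_mul_div_le hπ (fun x => |v x|) π
  have h1 : densSq π π = 1 := by
    rw [← hsum]
    exact sum_congr rfl fun x _ => by have := (hπ x).ne'; field_simp
  have h2 : densSq π (fun x => |v x|) = densSq π v := by simp [densSq]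
  rw [h1, h2, Real.sqrt_one, mul_one] at h
  refine le_of_eq_of_le (sum_congr rfl fun x _ => ?_) h
  have := (hπ x).ne'
  field_simp

lemma sum_sq_apply_le (h0 : ∀ x y, 0 ≤ P x y) (h1 : ∀ x, ∑ y, P x y = 1) (hπ : ∀ x, 0 < π x)
    (hst : push P π = π) (f : X → ℝ) :
    ∑ x, π x * |∑ y, P x y * f y| ^ 2 ≤ ∑ x, π x * |f x| ^ 2 := by
  calc ∑ x, π x * |∑ y, P x y * f y| ^ 2 ≤ ∑ x, π x * ∑ y, P x y * f y ^ 2 := by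
        refine sum_le_sum fun x _ => mul_le_mul_of_nonneg_left ?_ (hπ x).le
        rw [sq_abs]
        exact Real.pow_arith_mean_le_arith_mean_pow_of_even univ _ _ (fun y _ => h0 x y) (h1 x)
          even_two
    _ = ∑ x, π x * |f x| ^ 2 := by
        rw [← sum_push_mul, hst]
        simp only [sq_abs]

lemma sqrt_sum_sq_apply_le_of_specGap (h0 : ∀ x y, 0 ≤ P x y) (h1 : ∀ x, ∑ y, P x y = 1)
    (hπ : ∀ x, 0 < π x) (hst : push P π = π) {γ : ℝ} (hγ : γ ≤ specGap P π)
    {f : X → ℝ} (hf : ∑ x, π x * f x = 0) :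
    √(∑ x, π x * |∑ y, P x y * f y| ^ 2) ≤ (1 - γ) * √(∑ x, π x * |f x| ^ 2) := by
  by_cases hf0 : f = 0
  · simp [hf0]
  have hpos : 0 < ∑ x, π x * |f x| ^ 2 := by
    obtain ⟨x, hx⟩ := Function.ne_iff.mp hf0
    refine sum_pos' (fun x _ => mul_nonneg (hπ x).le (sq_nonneg _)) ⟨x, mem_univ x, ?_⟩
    exact mul_pos (hπ x) (pow_pos (abs_pos.mpr hx) 2)
  rw [← div_le_iff₀ (Real.sqrt_pos.mpr hpos)]
  refine le_trans ?_ (le_sub_comm.mp hγ)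
  refine le_csSup ⟨1, ?_⟩ ⟨f, hf0, hf, rfl⟩
  rintro r ⟨g, -, -, rfl⟩
  exact div_le_one_of_le₀ (Real.sqrt_le_sqrt (sum_sq_apply_le h0 h1 hπ hst g)) (Real.sqrt_nonneg _)

lemma sqrt_densSq_push_le (h0 : ∀ x y, 0 ≤ P x y) (h1 : ∀ x, ∑ y, P x y = 1)
    (hπ : ∀ x, 0 < π x) (hst : push P π = π) {γ : ℝ} (hγ1 : γ ≤ 1) (hγ : γ ≤ specGap P π)
    {v : X → ℝ} (hv : ∑ x, v x = 0) :
    √(densSq π (push P v)) ≤ (1 - γ) * √(densSq π v) := by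
  set f : X → ℝ := fun y => push P v y / π y
  have hπf : ∀ y, π y * f y = push P v y := fun y => mul_div_cancel₀ _ (hπ y).ne'
  have hf : ∑ x, π x * f x = 0 := by simp only [hπf, sum_push_eq h1, hv]
  have hgap := sqrt_sum_sq_apply_le_of_specGap h0 h1 hπ hst hγ hf
  have hnorm : ∑ x, π x * |f x| ^ 2 = densSq π (push P v) := by
    refine sum_congr rfl fun x _ => ?_
    have := (hπ x).ne'
    simp only [f, sq_abs]
    field_simp
  have hdual : densSq π (push P v) = ∑ x, v x * ∑ y, P x y * f y := by
    rw [← sum_push_mul]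
    exact sum_congr rfl fun x _ => by simp only [f]; ring
  have hcs := sum_mul_div_le hπ v (fun x => π x * ∑ y, P x y * f y)
  have e1 : ∑ x, v x * (π x * ∑ y, P x y * f y) / π x = densSq π (push P v) := by
    rw [hdual]
    refine sum_congr rfl fun x _ => ?_
    have := (hπ x).ne'
    field_simp
  have e2 : densSq π (fun x => π x * ∑ y, P x y * f y) = ∑ x, π x * |∑ y, P x y * f y| ^ 2 := by
    refine sum_congr rfl fun x _ => ?_
    have := (hπ x).ne'
    rw [sq_abs]
    field_simp
  rw [e1, e2] at hcs
  rw [hnorm] at hgap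
  set N := densSq π (push P v)
  have hN : √N * √N = N := Real.mul_self_sqrt (densSq_nonneg hπ _)
  rcases (Real.sqrt_nonneg N).eq_or_lt with h | h
  · rw [← h]
    exact mul_nonneg (by linarith) (Real.sqrt_nonneg _)
  · refine le_of_mul_le_mul_right ?_ h
    calc √N * √N = N := hN
      _ ≤ _ := hcs
      _ ≤ √(densSq π v) * ((1 - γ) * √N) := mul_le_mul_of_nonneg_left hgap (Real.sqrt_nonneg _)
      _ = _ := by ring

lemma sqrt_densSq_resolvent_le (h0 : ∀ x y, 0 ≤ P x y) (h1 : ∀ x, ∑ y, P x y = 1)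
    (hπ : ∀ x, 0 < π x) (hst : push P π = π) {γ δ : ℝ} (hγ1 : γ ≤ 1)
    (hγ : γ ≤ specGap P π) (hδ0 : 0 ≤ δ) (hδ1 : δ ≤ 1) {v w : X → ℝ} (hv : ∑ x, v x = 0)
    (hvw : ∀ y, v y = δ * w y + (1 - δ) * push P v y) :
    γ * √(densSq π v) ≤ δ * √(densSq π w) := by
  have hpush := sqrt_densSq_push_le h0 h1 hπ hst hγ1 hγ hv
  have hexp : densSq π v = δ * ∑ x, v x * w x / π x + (1 - δ) * ∑ x, v x * push P v x / π x := by
    rw [mul_sum, mul_sum, ← sum_add_distrib]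
    refine sum_congr rfl fun x _ => ?_
    rw [sq]
    nth_rewrite 2 [hvw x]
    ring
  have c1 := mul_le_mul_of_nonneg_left (sum_mul_div_le hπ v w) hδ0
  have c2 := mul_le_mul_of_nonneg_left (sum_mul_div_le hπ v (push P v)) (sub_nonneg.mpr hδ1)
  have hN : √(densSq π v) * √(densSq π v) = densSq π v := Real.mul_self_sqrt (densSq_nonneg hπ _)
  have hnn := Real.sqrt_nonneg (densSq π v)
  set a := √(densSq π v)
  set b := √(densSq π w)
  set c := √(densSq π (push P v))
  rcases hnn.eq_or_lt with h | h
  · rw [← h, mul_zero]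
    exact mul_nonneg hδ0 (Real.sqrt_nonneg _)
  · refine le_of_mul_le_mul_right ?_ h
    have c3 : (1 - δ) * (a * c) ≤ (1 - δ) * (a * ((1 - γ) * a)) :=
      mul_le_mul_of_nonneg_left (mul_le_mul_of_nonneg_left hpush hnn) (sub_nonneg.mpr hδ1)
    have c4 : 0 ≤ δ * ((1 - γ) * (a * a)) :=
      mul_nonneg hδ0 (mul_nonneg (sub_nonneg.mpr hγ1) (mul_nonneg hnn hnn))
    nlinarith

lemma sum_abs_resolvent_le (h0 : ∀ x y, 0 ≤ P x y) (h1 : ∀ x, ∑ y, P x y = 1) {δ : ℝ}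
    (hδ0 : 0 ≤ δ) (hδ1 : δ ≤ 1) {v w : X → ℝ}
    (hvw : ∀ y, v y = δ * w y + (1 - δ) * push P v y) (m : ℕ) :
    ∑ x, |v x| ≤ m * (δ * ∑ x, |w x|) + ∑ x, |(push P)^[m] v x| := by
  have hw : ∀ k : ℕ, ∑ x, |(push P)^[k] w x| ≤ ∑ x, |w x| := by
    intro k
    induction k with
    | zero => simp
    | succ k ih =>
      rw [Function.iterate_succ_apply']
      exact (sum_abs_push_le h0 h1 _).trans ih
  have hit : ∀ (k : ℕ) (y : X), (push P)^[k] v y =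
      δ * (push P)^[k] w y + (1 - δ) * (push P)^[k + 1] v y := by
    intro k
    induction k with
    | zero => simpa using hvw
    | succ k ih =>
      intro y
      rw [Function.iterate_succ_apply', funext ih, push_linear,
        ← Function.iterate_succ_apply' (push P), ← Function.iterate_succ_apply' (push P)]
  induction m with
  | zero => simp
  | succ k ih =>
    refine ih.trans ?_
    have : ∑ x, |(push P)^[k] v x| ≤ δ * ∑ x, |w x| + ∑ x, |(push P)^[k + 1] v x| := by
      calc ∑ x, |(push P)^[k] v x|
          ≤ ∑ x, (δ * |(push P)^[k] w x| + |(push P)^[k + 1] v x|) := by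
            refine sum_le_sum fun x _ => ?_
            rw [hit k x]
            refine (abs_add_le _ _).trans ?_
            rw [abs_mul, abs_mul, abs_of_nonneg hδ0, abs_of_nonneg (sub_nonneg.mpr hδ1)]
            exact add_le_add le_rfl (mul_le_of_le_one_left (abs_nonneg _) (by linarith))
        _ ≤ _ := by
            rw [sum_add_distrib, ← mul_sum]
            exact add_le_add (mul_le_mul_of_nonneg_left (hw k) hδ0) le_rfl
    push_cast
    linarith

lemma sqrt_densSq_iterate_push_le (h0 : ∀ x y, 0 ≤ P x y) (h1 : ∀ x, ∑ y, P x y = 1)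
    (hπ : ∀ x, 0 < π x) (hst : push P π = π) {γ : ℝ} (hγ1 : γ ≤ 1) (hγ : γ ≤ specGap P π)
    {v : X → ℝ} (hv : ∑ x, v x = 0) (m : ℕ) :
    √(densSq π ((push P)^[m] v)) ≤ (1 - γ) ^ m * √(densSq π v) := by
  have hz : ∀ k : ℕ, ∑ x, (push P)^[k] v x = 0 := by
    intro k
    induction k with
    | zero => simpa using hv
    | succ k ih => rw [Function.iterate_succ_apply', sum_push_eq h1, ih]
  induction m with
  | zero => simp
  | succ k ih =>
    rw [Function.iterate_succ_apply', pow_succ']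
    refine (sqrt_densSq_push_le h0 h1 hπ hst hγ1 hγ (hz k)).trans ?_
    rw [mul_assoc]
    exact mul_le_mul_of_nonneg_left ih (sub_nonneg.mpr hγ1)

lemma densSq_sub_le (hπ : ∀ x, 0 < π x) (hsum : ∑ x, π x = 1) {μ : X → ℝ} {α : ℝ} (hα : 0 < α)
    (hμ0 : ∀ x, 0 ≤ μ x) (hμ1 : ∑ x, μ x = 1) (hμ : ∀ x, α * μ x ≤ π x) :
    densSq π (fun x => μ x - π x) ≤ 1 / α := by
  calc densSq π (fun x => μ x - π x) ≤ ∑ x, (μ x / α - 2 * μ x + π x) := by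
        refine sum_le_sum fun x _ => ?_
        have hx := hπ x
        rw [div_le_iff₀ hx]
        have : μ x * μ x ≤ μ x / α * π x := by
          rw [div_mul_eq_mul_div, le_div_iff₀ hα]
          nlinarith [mul_le_mul_of_nonneg_left (hμ x) (hμ0 x)]
        nlinarith
    _ ≤ 1 / α := by
        rw [sum_add_distrib, sum_sub_distrib, ← mul_sum, ← sum_div, hμ1, hsum]
        linarith

/-- Mixing bound for the PageRank distribution `ρ` of a chain with a spectral gap. -/
lemma sum_abs_pageRank_sub_le (h0 : ∀ x y, 0 ≤ P x y) (h1 : ∀ x, ∑ y, P x y = 1)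
    (hπ : ∀ x, 0 < π x) (hsum : ∑ x, π x = 1) (hst : push P π = π) {γ δ α : ℝ} (hγ0 : 0 < γ)
    (hγ1 : γ ≤ 1) (hγ : γ ≤ specGap P π) (hδ0 : 0 < δ) (hδ1 : δ ≤ 1) (hα0 : 0 < α) (hα1 : α ≤ 1)
    {μ ρ : X → ℝ} (hμ0 : ∀ x, 0 ≤ μ x) (hμ1 : ∑ x, μ x = 1) (hμ : ∀ x, α * μ x ≤ π x)
    (hρ : ∀ y, ρ y = δ * μ y + (1 - δ) * push P ρ y) :
    ∑ x, |ρ x - π x| ≤ 3 * δ / γ * (1 + Real.log (1 / α)) := by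
  set v : X → ℝ := fun x => ρ x - π x
  set w : X → ℝ := fun x => μ x - π x
  have hρ1 : ∑ x, ρ x = 1 := by
    have h : ∑ y, ρ y = ∑ y, (δ * μ y + (1 - δ) * push P ρ y) := sum_congr rfl fun y _ => hρ y
    rw [sum_add_distrib, ← mul_sum, ← mul_sum, sum_push_eq h1, hμ1] at h
    nlinarith
  have hv : ∑ x, v x = 0 := by simp [v, hρ1, hsum]
  have hvw : ∀ y, v y = δ * w y + (1 - δ) * push P v y := by
    intro y
    have h := congrFun (push_linear P 1 (-1) ρ π) y
    simp only [hst, one_mul, neg_mul, ← sub_eq_add_neg] at h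
    simp only [v, w, h]
    linarith [hρ y]
  have hw : ∑ x, |w x| ≤ 2 := by
    calc ∑ x, |w x| ≤ ∑ x, (μ x + π x) := sum_le_sum fun x _ => by
          rw [abs_le]
          constructor <;> simp only [w] <;> linarith [hμ0 x, hπ x]
      _ = 2 := by rw [sum_add_distrib, hμ1, hsum]; norm_num
  have hlog : 0 ≤ Real.log (1 / α) := Real.log_nonneg (by rw [le_div_iff₀ hα0]; linarith)
  set m : ℕ := ⌈Real.log (1 / α) / γ⌉₊
  have hm1 : Real.log (1 / α) ≤ m * γ := (div_le_iff₀ hγ0).mp (Nat.le_ceil _)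
  have hm2 : (m : ℝ) < Real.log (1 / α) / γ + 1 := Nat.ceil_lt_add_one (div_nonneg hlog hγ0.le)
  have hpow : (1 - γ) ^ m ≤ α := by
    calc (1 - γ) ^ m ≤ Real.exp (-γ) ^ m :=
          pow_le_pow_left₀ (by linarith) (by linarith [Real.add_one_le_exp (-γ)]) m
      _ = Real.exp (-(m * γ)) := by rw [← Real.exp_nat_mul]; ring_nf
      _ ≤ Real.exp (Real.log α) := Real.exp_le_exp.mpr (by
          rw [one_div, Real.log_inv] at hm1; linarith)
      _ = α := Real.exp_log hα0
  have hsqrtw : √(densSq π w) ≤ 1 / α := by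
    refine Real.sqrt_le_iff.mpr ⟨by positivity, (densSq_sub_le hπ hsum hα0 hμ0 hμ1 hμ).trans ?_⟩
    have : 1 ≤ 1 / α := by rw [le_div_iff₀ hα0]; linarith
    nlinarith
  have hsqrtv : √(densSq π v) ≤ δ / (γ * α) := by
    have h := sqrt_densSq_resolvent_le h0 h1 hπ hst hγ1 hγ hδ0.le hδ1 hv hvw
    rw [le_div_iff₀ (by positivity)]
    have h' := mul_le_mul_of_nonneg_left hsqrtw hδ0.le
    have h'' := mul_le_mul_of_nonneg_right (h.trans h') hα0.le
    rw [mul_assoc δ, one_div_mul_cancel hα0.ne'] at h''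
    linarith
  have hit : ∑ x, |(push P)^[m] v x| ≤ δ / γ := by
    refine (sum_abs_le_sqrt_densSq hπ hsum _).trans
      ((sqrt_densSq_iterate_push_le h0 h1 hπ hst hγ1 hγ hv m).trans ?_)
    refine (mul_le_mul hpow hsqrtv (Real.sqrt_nonneg _) hα0.le).trans_eq ?_
    field_simp
  have hmain := sum_abs_resolvent_le h0 h1 hδ0.le hδ1 hvw m
  have hδγ : δ ≤ δ / γ := by rw [le_div_iff₀ hγ0]; nlinarith
  have hmw : m * (δ * ∑ x, |w x|) ≤ (Real.log (1 / α) / γ + 1) * (δ * 2) := by gcongr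
  have e : Real.log (1 / α) / γ * δ = δ / γ * Real.log (1 / α) := by ring
  have e' : 0 ≤ δ / γ * Real.log (1 / α) := by positivity
  have e'' : 3 * δ / γ * (1 + Real.log (1 / α)) = 3 * (δ / γ) + 3 * (δ / γ * Real.log (1 / α)) := by
    ring
  rw [e'']
  nlinarith

end gap

/-- PageRank distributions of two chains differ by at most the chance of meeting a row on which
the chains differ before the first restart. -/
lemma sum_abs_pageRank_sub_pageRank_le {X : Type*} [Fintype X] {P Q : X → X → ℝ}
    (hP0 : ∀ x y, 0 ≤ P x y) (hP1 : ∀ x, ∑ y, P x y = 1)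
    (hQ0 : ∀ x y, 0 ≤ Q x y) (hQ1 : ∀ x, ∑ y, Q x y = 1) {δ : ℝ} (hδ0 : 0 < δ) (hδ1 : δ ≤ 1)
    {μ ρ τ : X → ℝ} (hμ0 : ∀ x, 0 ≤ μ x) (hμ1 : ∑ x, μ x = 1)
    (hρ : ∀ y, ρ y = δ * μ y + (1 - δ) * push P ρ y)
    (hτ : ∀ y, τ y = δ * μ y + (1 - δ) * push Q τ y)
    (S : Finset X) (hS : ∀ x ∉ S, Q x = P x) :
    δ * ∑ x, |τ x - ρ x| ≤ 2 * ∑ x ∈ S, ρ x := by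
  classical
  have ha0 : 0 ≤ 1 - δ := sub_nonneg.mpr hδ1
  have ha1 : 1 - δ < 1 := by linarith
  set K : X → X → ℝ := fun x y => if x ∈ S then 0 else P x y with hK
  have hK0 : ∀ x y, 0 ≤ K x y := fun x y => by
    simp only [hK]; split_ifs <;> simp [hP0]
  have hKP : ∀ x y, K x y ≤ P x y := fun x y => by
    simp only [hK]; split_ifs <;> simp [hP0]
  have hKQ : ∀ x y, K x y ≤ Q x y := fun x y => by
    simp only [hK]; split_ifs with h <;> simp [hQ0, hS x, h]
  have hK1 : ∀ x, ∑ y, K x y ≤ 1 := fun x => (sum_le_sum fun y _ => hKP x y).trans_eq (hP1 x)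
  obtain ⟨σ, hσ⟩ := exists_eq_add_mul_push hK0 hK1 ha0 ha1 (fun y => δ * μ y)
  have key : ∀ (R : X → X → ℝ) (θ : X → ℝ), (∀ x y, 0 ≤ R x y) → (∀ x, ∑ y, R x y = 1) →
      (∀ x y, K x y ≤ R x y) → (∀ y, θ y = δ * μ y + (1 - δ) * push R θ y) →
      (∀ x, σ x ≤ θ x) ∧ ∑ x, θ x = 1 := by
    intro R θ hR0 hR1 hKR hθ
    have hθ0 := nonneg_of_mul_push_le hR0 (fun x => (hR1 x).le) ha0 ha1 (v := θ)
      (fun y => by have := mul_nonneg hδ0.le (hμ0 y); linarith [hθ y])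
    constructor
    · intro x
      refine sub_nonneg.mp (nonneg_of_mul_push_le hK0 hK1 ha0 ha1 (v := fun x => θ x - σ x) ?_ x)
      intro y
      have h := congrFun (push_linear K 1 (-1) θ σ) y
      simp only [one_mul, neg_mul, ← sub_eq_add_neg] at h
      have hle : push K θ y ≤ push R θ y :=
        sum_le_sum fun x _ => mul_le_mul_of_nonneg_left (hKR x y) (hθ0 x)
      rw [h]
      nlinarith [hθ y, hσ y, mul_le_mul_of_nonneg_left hle ha0]
    · have h : ∑ y, θ y = ∑ y, (δ * μ y + (1 - δ) * push R θ y) := sum_congr rfl fun y _ => hθ y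
      rw [sum_add_distrib, ← mul_sum, ← mul_sum, sum_push_eq hR1, hμ1] at h
      nlinarith
  obtain ⟨hσρ, hρ1⟩ := key P ρ hP0 hP1 hKP hρ
  obtain ⟨hστ, hτ1⟩ := key Q τ hQ0 hQ1 hKQ hτ
  have hσ0 := nonneg_of_mul_push_le hK0 hK1 ha0 ha1 (v := σ)
    (fun y => by have := mul_nonneg hδ0.le (hμ0 y); linarith [hσ y])
  have hmass : ∑ y, σ y = δ + (1 - δ) * (∑ x, σ x - ∑ x ∈ S, σ x) := by
    have h : ∑ y, σ y = ∑ y, (δ * μ y + (1 - δ) * push K σ y) := sum_congr rfl fun y _ => hσ y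
    rw [sum_add_distrib, ← mul_sum, ← mul_sum, sum_push, hμ1] at h
    have h' : ∑ x, σ x * ∑ y, K x y = ∑ x, σ x - ∑ x ∈ S, σ x := by
      rw [eq_sub_iff_add_eq, ← sum_subset (subset_univ Sᶜ), ← sum_add_sum_compl S σ, add_comm]
      · congr 1
        refine sum_congr rfl fun x hx => ?_
        simp [hK, mem_compl.mp hx, hP1]
      · intro x _ hx
        have : x ∈ S := by simpa using hx
        simp [hK, this]
    rw [h'] at h
    linarith
  have hdiff : ∑ x, |τ x - ρ x| ≤ 2 * (1 - ∑ x, σ x) := by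
    calc ∑ x, |τ x - ρ x| ≤ ∑ x, ((τ x - σ x) + (ρ x - σ x)) := sum_le_sum fun x _ => by
          rw [abs_le]
          constructor <;> linarith [hσρ x, hστ x]
      _ = 2 * (1 - ∑ x, σ x) := by
          rw [sum_add_distrib, sum_sub_distrib, sum_sub_distrib, hρ1, hτ1]; ring
  have hσS0 : 0 ≤ ∑ x ∈ S, σ x := sum_nonneg fun x _ => hσ0 x
  have hσS : ∑ x ∈ S, σ x ≤ ∑ x ∈ S, ρ x := sum_le_sum fun x _ => hσρ x
  nlinarith [mul_le_mul_of_nonneg_left hdiff hδ0.le, mul_nonneg hδ0.le hσS0]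

/-- A PageRank distribution is dominated by any stationary measure dominating the restart
distribution. -/
lemma mul_pageRank_le {X : Type*} [Fintype X] {P : X → X → ℝ} {π μ ρ : X → ℝ}
    (h0 : ∀ x y, 0 ≤ P x y) (h1 : ∀ x, ∑ y, P x y = 1) (hst : push P π = π) {δ α : ℝ}
    (hδ0 : 0 < δ) (hδ1 : δ ≤ 1) (hμ : ∀ x, α * μ x ≤ π x)
    (hρ : ∀ y, ρ y = δ * μ y + (1 - δ) * push P ρ y) (x : X) : α * ρ x ≤ π x := by
  refine sub_nonneg.mp (nonneg_of_mul_push_le h0 (fun x => (h1 x).le) (sub_nonneg.mpr hδ1)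
    (show 1 - δ < 1 by linarith) (v := fun x => π x - α * ρ x) ?_ x)
  intro y
  have h := congrFun (push_linear P 1 (-α) π ρ) y
  simp only [one_mul, neg_mul, ← sub_eq_add_neg, hst] at h
  rw [h]
  have e : α * ρ y = δ * (α * μ y) + (1 - δ) * (α * push P ρ y) := by rw [hρ y]; ring
  nlinarith [mul_le_mul_of_nonneg_left (hμ y) hδ0.le]

/-- (Spread stationary distributions.) There is an absolute
constant `C > 0` such that: if `π` is the stationary distribution of `P` on `n`
states with spectral gap at least `γ` and `α/n ≤ π(x) ≤ 1/(αn)` for all `x`, and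
`P̃` differs from `P` on at most `εn` rows, then for a suitable `δ ∈ (0,1]` the
stationary distribution `π̂` of the PageRank chain `(1−δ)P̃ + δ𝟙ᵀ(1/n)` (uniform
restart) satisfies `d_TV(π̂, π) ≤ (C/α)√((ε/γ)(1 + log(1/(αεγ))))`. -/
theorem uniform_restart_recovery :
    ∃ C : ℝ, 0 < C ∧
      ∀ (X : Type) [Fintype X] (n : ℕ),
        Fintype.card X = n → 1 ≤ n →
        ∀ (P Pt : X → X → ℝ) (π : X → ℝ) (α γ ε : ℝ),
        (∀ x y, 0 ≤ P x y) → (∀ x, ∑ y, P x y = 1) →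
        (∀ x y, 0 ≤ Pt x y) → (∀ x, ∑ y, Pt x y = 1) →
        (∀ x, 0 ≤ π x) → (∑ x, π x = 1) →
        (∀ y, ∑ x, π x * P x y = π y) →
        0 < γ → γ ≤ 1 → γ ≤ specGap P π →
        0 < α → α ≤ 1 →
        (∀ x, α / n ≤ π x) → (∀ x, π x ≤ 1 / (α * n)) →
        0 < ε → ε < 1 →
        ((Nat.card {x : X // ∃ y, Pt x y ≠ P x y} : ℝ) ≤ ε * n) →
        ∃ δ : ℝ, 0 < δ ∧ δ ≤ 1 ∧
          ∀ πhat : X → ℝ, (∀ x, 0 ≤ πhat x) → (∑ x, πhat x = 1) →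
          (∀ y, ∑ x, πhat x * ((1 - δ) * Pt x y + δ * (1 / n)) = πhat y) →
          (1 / 2) * ∑ x, |πhat x - π x| ≤
            (C / α) * Real.sqrt ((ε / γ) * (1 + Real.log (1 / (α * ε * γ)))) := by
  classical
  refine ⟨3, by norm_num, ?_⟩
  intro X _ n hcard hn P Pt π α γ ε hP0 hP1 hQ0 hQ1 hπ0 hsum hst hγ0 hγ1 hγ hα0 hα1 hlow hup
    hε0 hε1 hS
  have hn0 : (0 : ℝ) < n := by exact_mod_cast hn
  have hπ : ∀ x, 0 < π x := fun x => (div_pos hα0 hn0).trans_le (hlow x)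
  have hst' : push P π = π := funext hst
  set L := 1 + Real.log (1 / (α * ε * γ)) with hL
  have hLα : 1 + Real.log (1 / α) ≤ L := by
    have : α * ε * γ ≤ α := by
      rw [mul_assoc]
      exact mul_le_of_le_one_right hα0.le (mul_le_one₀ hε1.le hγ0.le hγ1)
    have := Real.log_le_log (by positivity) (one_div_le_one_div_of_le (by positivity) this)
    linarith
  have hL1 : 1 ≤ L := by
    have : 0 ≤ Real.log (1 / α) := Real.log_nonneg (by rw [le_div_iff₀ hα0]; linarith)
    linarith
  have hL0 : 0 < L := by linarith
  set t := √(ε / γ * L)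
  have ht0 : 0 < t := Real.sqrt_pos.mpr (by positivity)
  have ht2 : t ^ 2 = ε / γ * L := Real.sq_sqrt (by positivity)
  rcases le_or_gt α t with hαt | htα
  · refine ⟨1, one_pos, le_rfl, fun πhat hp0 hp1 _ => ?_⟩
    have : ∑ x, |πhat x - π x| ≤ 2 := by
      calc ∑ x, |πhat x - π x| ≤ ∑ x, (πhat x + π x) := sum_le_sum fun x _ => by
            rw [abs_le]
            constructor <;> linarith [hp0 x, hπ0 x]
        _ = 2 := by rw [sum_add_distrib, hp1, hsum]; norm_num
    have h3 : 1 ≤ t / α := (one_le_div hα0).mpr hαt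
    have : 3 / α * t = 3 * (t / α) := by ring
    rw [this]
    linarith
  · set δ := γ / L * (t / α) with hδ
    have hδ0 : 0 < δ := by positivity
    have hδ1 : δ ≤ 1 :=
      mul_le_one₀ ((div_le_one hL0).mpr (by linarith)) (by positivity) ((div_le_one hα0).mpr htα.le)
    refine ⟨δ, hδ0, hδ1, fun πhat hp0 hp1 hpst => ?_⟩
    set μ : X → ℝ := fun _ => 1 / n
    have hμ0 : ∀ x, 0 ≤ μ x := fun x => by positivity
    have hμ1 : ∑ x, μ x = 1 := by simp [μ, hcard, hn0.ne']
    have hμ : ∀ x, α * μ x ≤ π x := fun x => by simpa [μ, div_eq_mul_inv] using hlow x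
    obtain ⟨ρ, hρ⟩ := exists_eq_add_mul_push hP0 (fun x => (hP1 x).le) (sub_nonneg.mpr hδ1)
      (show 1 - δ < 1 by linarith) (fun y => δ * μ y)
    have hτ : ∀ y, πhat y = δ * μ y + (1 - δ) * push Pt πhat y := by
      intro y
      rw [← hpst y]
      simp only [mul_add, sum_add_distrib, push, mul_sum, ← sum_mul, hp1, one_mul, μ]
      rw [add_comm]
      congr 1
      exact sum_congr rfl fun x _ => by ring
    set S : Finset X := univ.filter fun x => ∃ y, Pt x y ≠ P x y with hSdef
    have hScard : (#S : ℝ) ≤ ε * n := by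
      rwa [Nat.card_eq_fintype_card, Fintype.card_subtype] at hS
    have hA := sum_abs_pageRank_sub_le hP0 hP1 hπ hsum hst' hγ0 hγ1 hγ hδ0 hδ1 hα0 hα1 hμ0 hμ1 hμ hρ
    have hB := sum_abs_pageRank_sub_pageRank_le hP0 hP1 hQ0 hQ1 hδ0 hδ1 hμ0 hμ1 hρ hτ S
      (fun x hx => by
        simp only [hSdef, mem_filter, mem_univ, true_and, not_exists, not_not] at hx
        exact funext hx)
    have hρS : ∑ x ∈ S, ρ x ≤ ε / α ^ 2 := by
      calc ∑ x ∈ S, ρ x ≤ ∑ x ∈ S, 1 / (α * n) / α := sum_le_sum fun x _ => by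
            rw [le_div_iff₀ hα0, mul_comm]
            exact (mul_pageRank_le hP0 hP1 hst' hδ0 hδ1 hμ hρ x).trans (hup x)
        _ = #S * (1 / (α * n) / α) := by rw [sum_const, nsmul_eq_mul]
        _ ≤ ε * n * (1 / (α * n) / α) := by gcongr
        _ = ε / α ^ 2 := by field_simp
    have hA' : ∑ x, |ρ x - π x| ≤ 3 * (t / α) := by
      refine hA.trans ((mul_le_mul_of_nonneg_left hLα (by positivity)).trans_eq ?_)
      rw [hδ]
      field_simp
    have hB' : ∑ x, |πhat x - ρ x| ≤ 2 * (t / α) := by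
      refine le_of_mul_le_mul_left (hB.trans ?_) hδ0
      have : δ * (2 * (t / α)) = 2 * (ε / α ^ 2) := by
        have : δ * (2 * (t / α)) = 2 * (γ / L * t ^ 2 / α ^ 2) := by rw [hδ]; ring
        rw [this, ht2]
        field_simp
      linarith
    have htri : ∑ x, |πhat x - π x| ≤ ∑ x, |πhat x - ρ x| + ∑ x, |ρ x - π x| := by
      rw [← sum_add_distrib]
      exact sum_le_sum fun x _ => abs_sub_le _ _ _
    have e : 3 / α * t = 3 * (t / α) := by ring
    have : 0 < t / α := by positivity
    rw [e]
    linarith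
end
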